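/- Let K, d be positive integers, let B ⊆ ℝ^d be an open convex set, let f : ℝ^d → ℝ^K be differentiable on B with 0 < f_k(x) < 1 for every k and every x ∈ B and Σ_k f_k(x) = 1 on B, and for x ∈ B let J(x) ∈ ℝ^{K×d} denote the Jacobian of f at x and F_f(x) := diag(f(x))⁻¹. Fix p ∈ [2, ∞] and L > 0. If ‖F_f(x)^{1/2} J(x)‖_{p↪2} ≤ L / √K for every x ∈ B, then f is L-Lipschitz on B with respect to the Euclidean norms on ℝ^d and ℝ^K, and each component function f_k is (L/√K)-Lipschitz on B. -/

import Mathlib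

open Matrix
open scoped ENNReal BigOperators

/-- Entrywise ℓ_p norm of a vector in ℝ^n, for p ∈ [1,∞] (with the max convention at p = ∞). -/
noncomputable def lpNorm (p : ℝ≥0∞) {n : ℕ} (x : Fin n → ℝ) : ℝ :=
  if p = ∞ then ⨆ i, |x i| else (∑ i, |x i| ^ p.toReal) ^ (1 / p.toReal)

/-- Vector-induced operator norm ‖A‖_{p↪q} = sup_{x ≠ 0} ‖Ax‖_q / ‖x‖_p. -/
noncomputable def opNorm {m n : ℕ} (p q : ℝ≥0∞) (A : Matrix (Fin m) (Fin n) ℝ) : ℝ :=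
  ⨆ x : {x : Fin n → ℝ // x ≠ 0}, lpNorm q (A.mulVec x.val) / lpNorm p x.val

/-- Frobenius norm of a matrix. -/
noncomputable def frobeniusNorm {m n : ℕ} (A : Matrix (Fin m) (Fin n) ℝ) : ℝ :=
  Real.sqrt (∑ i, ∑ j, (A i j) ^ 2)

/-- ‖A‖_{2,∞}: the maximum ℓ₂ norm of a column of A. -/
noncomputable def maxColNorm {m n : ℕ} (A : Matrix (Fin m) (Fin n) ℝ) : ℝ :=
  ⨆ j : Fin n, lpNorm 2 (fun i => A i j)

/-- Largest eigenvalue of a real symmetric matrix. -/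
noncomputable def lambdaMax {d : ℕ} (A : Matrix (Fin d) (Fin d) ℝ) (hA : A.IsHermitian) : ℝ :=
  ⨆ i, hA.eigenvalues i

lemma lpNorm_two_eq_sqrt {n : ℕ} (x : Fin n → ℝ) :
    lpNorm 2 x = Real.sqrt (∑ i, x i ^ 2) := by
  simp [lpNorm, Real.sqrt_eq_rpow]

lemma lpNorm_nonneg (p : ℝ≥0∞) {n : ℕ} (x : Fin n → ℝ) : 0 ≤ lpNorm p x := by
  unfold lpNorm
  split_ifs
  · exact Real.iSup_nonneg fun i => abs_nonneg _
  · positivity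

lemma abs_apply_le_lpNorm {p : ℝ≥0∞} (hp : p ≠ 0) {n : ℕ} (x : Fin n → ℝ) (i : Fin n) :
    |x i| ≤ lpNorm p x := by
  unfold lpNorm
  split_ifs with h
  · exact le_ciSup (f := fun i => |x i|) (Set.finite_range _).bddAbove i
  · have hr : 0 < p.toReal := ENNReal.toReal_pos hp h
    rw [one_div, Real.le_rpow_inv_iff_of_pos (abs_nonneg _) (by positivity) hr]
    exact Finset.single_le_sum (f := fun i => |x i| ^ p.toReal)
      (fun j _ => by positivity) (Finset.mem_univ i)

lemma lpNorm_le_lpNorm_two {p : ℝ≥0∞} (hp : 2 ≤ p) {n : ℕ} (x : Fin n → ℝ) :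
    lpNorm p x ≤ lpNorm 2 x := by
  have hx := abs_apply_le_lpNorm two_ne_zero x
  have hN := lpNorm_nonneg 2 x
  by_cases h : p = ∞
  · rw [lpNorm, if_pos h]
    exact Real.iSup_le hx hN
  · have hr : 2 ≤ p.toReal := by
      simpa using ENNReal.toReal_mono h hp
    have hsq : ∑ i, |x i| ^ (2 : ℝ) = lpNorm 2 x ^ (2 : ℝ) := by
      simp only [Real.rpow_two, sq_abs, lpNorm_two_eq_sqrt]
      rw [Real.sq_sqrt (by positivity)]
    have hsplit {a : ℝ} (ha : 0 ≤ a) : a ^ p.toReal = a ^ (p.toReal - 2) * a ^ (2 : ℝ) := by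
      rw [← Real.rpow_add_of_nonneg ha (by linarith) (by norm_num), sub_add_cancel]
    rw [lpNorm, if_neg h, one_div,
      Real.rpow_inv_le_iff_of_pos (by positivity) hN (by linarith), hsplit hN, ← hsq,
      Finset.mul_sum]
    refine Finset.sum_le_sum fun i _ => ?_
    rw [hsplit (abs_nonneg _)]
    gcongr
    exact hx i

lemma lpNorm_two_le_sqrt_mul {n : ℕ} {x : Fin n → ℝ} {c : ℝ} (hc : 0 ≤ c)
    (hx : ∀ i, |x i| ≤ c) : lpNorm 2 x ≤ Real.sqrt n * c := by
  rw [lpNorm_two_eq_sqrt]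
  refine Real.sqrt_le_iff.mpr ⟨by positivity, ?_⟩
  rw [mul_pow, Real.sq_sqrt (by positivity)]
  calc ∑ i, x i ^ 2 ≤ ∑ _i : Fin n, c ^ 2 :=
        Finset.sum_le_sum fun i _ => sq_le_sq' (neg_le_of_abs_le (hx i)) (le_of_abs_le (hx i))
    _ = n * c ^ 2 := by simp

lemma bddAbove_opNorm_two {p : ℝ≥0∞} (hp : p ≠ 0) {m n : ℕ} (A : Matrix (Fin m) (Fin n) ℝ) :
    BddAbove (Set.range fun x : {x : Fin n → ℝ // x ≠ 0} =>
      lpNorm 2 (A.mulVec x.val) / lpNorm p x.val) := by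
  refine ⟨Real.sqrt m * ∑ i, ∑ j, |A i j|, ?_⟩
  rintro _ ⟨⟨x, -⟩, rfl⟩
  refine div_le_of_le_mul₀ (lpNorm_nonneg p x) (by positivity) ?_
  rw [mul_assoc]
  refine lpNorm_two_le_sqrt_mul (mul_nonneg (by positivity) (lpNorm_nonneg p x)) fun i => ?_
  calc |A.mulVec x i| ≤ ∑ j, |A i j * x j| := by
        rw [Matrix.mulVec, dotProduct]
        exact Finset.abs_sum_le_sum_abs _ _
    _ ≤ ∑ j, |A i j| * lpNorm p x := by
        refine Finset.sum_le_sum fun j _ => ?_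
        rw [abs_mul]
        gcongr
        exact abs_apply_le_lpNorm hp x j
    _ = (∑ j, |A i j|) * lpNorm p x := by rw [Finset.sum_mul]
    _ ≤ (∑ i, ∑ j, |A i j|) * lpNorm p x := by
        refine mul_le_mul_of_nonneg_right ?_ (lpNorm_nonneg p x)
        exact Finset.single_le_sum (f := fun i => ∑ j, |A i j|)
          (fun j _ => by positivity) (Finset.mem_univ i)

lemma lpNorm_two_mulVec_le {p : ℝ≥0∞} (hp : p ≠ 0) {m n : ℕ} (A : Matrix (Fin m) (Fin n) ℝ)
    (x : Fin n → ℝ) : lpNorm 2 (A.mulVec x) ≤ opNorm p 2 A * lpNorm p x := by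
  by_cases hx : x = 0
  · subst hx
    have h : lpNorm 2 (A.mulVec 0) = 0 := by simp [lpNorm_two_eq_sqrt]
    rw [h]
    refine mul_nonneg (Real.iSup_nonneg fun y => ?_) (lpNorm_nonneg p _)
    exact div_nonneg (lpNorm_nonneg _ _) (lpNorm_nonneg _ _)
  · obtain ⟨i, hi⟩ := Function.ne_iff.mp hx
    have hpos : 0 < lpNorm p x := (abs_pos.mpr hi).trans_le (abs_apply_le_lpNorm hp x i)
    exact (div_le_iff₀ hpos).mp (le_ciSup (bddAbove_opNorm_two hp A) ⟨x, hx⟩)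

lemma abs_mulVec_apply_le_of_weighted {K d : ℕ} {w : Fin K → ℝ}
    (hw : ∀ k, 0 < w k ∧ w k < 1) (A : Matrix (Fin K) (Fin d) ℝ) {p : ℝ≥0∞} (hp : 2 ≤ p)
    {C : ℝ} (hC : 0 ≤ C)
    (hA : opNorm p 2 ((Matrix.diagonal fun k => (Real.sqrt (w k))⁻¹) * A) ≤ C)
    (v : Fin d → ℝ) (k : Fin K) : |A.mulVec v k| ≤ C * lpNorm 2 v := by
  have hp0 : p ≠ 0 := (two_pos.trans_le hp).ne'
  set D := Matrix.diagonal fun k => (Real.sqrt (w k))⁻¹ with hD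
  have hle : 1 ≤ (Real.sqrt (w k))⁻¹ :=
    (one_le_inv₀ (Real.sqrt_pos.mpr (hw k).1)).mpr (Real.sqrt_le_one.mpr (hw k).2.le)
  calc |A.mulVec v k| ≤ (Real.sqrt (w k))⁻¹ * |A.mulVec v k| :=
        le_mul_of_one_le_left (abs_nonneg _) hle
    _ = |(D * A).mulVec v k| := by
        rw [← Matrix.mulVec_mulVec, hD, Matrix.mulVec_diagonal, abs_mul,
          abs_of_nonneg (zero_le_one.trans hle)]
    _ ≤ lpNorm 2 ((D * A).mulVec v) := abs_apply_le_lpNorm two_ne_zero _ k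
    _ ≤ opNorm p 2 (D * A) * lpNorm p v := lpNorm_two_mulVec_le hp0 _ v
    _ ≤ C * lpNorm 2 v :=
        mul_le_mul hA (lpNorm_le_lpNorm_two hp v) (lpNorm_nonneg p v) hC

lemma abs_apply_sub_le_of_abs_mulVec_le {K d : ℕ} {B : Set (Fin d → ℝ)} (hB : Convex ℝ B)
    {f : (Fin d → ℝ) → (Fin K → ℝ)} {J : (Fin d → ℝ) → Matrix (Fin K) (Fin d) ℝ}
    (hdiff : ∀ x ∈ B,
      HasFDerivAt f (LinearMap.toContinuousLinearMap (Matrix.mulVecLin (J x))) x)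
    {x y : Fin d → ℝ} (hx : x ∈ B) (hy : y ∈ B) (k : Fin K) {C : ℝ}
    (hJ : ∀ z ∈ B, |(J z).mulVec (x - y) k| ≤ C) : |f x k - f y k| ≤ C := by
  have hmem : ∀ t ∈ Set.Icc (0 : ℝ) 1, y + t • (x - y) ∈ B := fun t ht =>
    hB.add_smul_sub_mem hy hx ht
  have hderiv : ∀ t ∈ Set.Icc (0 : ℝ) 1, HasDerivWithinAt (fun t => f (y + t • (x - y)) k)
      ((J (y + t • (x - y))).mulVec (x - y) k) (Set.Icc 0 1) t := by
    intro t ht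
    have hline : HasDerivAt (fun t : ℝ => y + t • (x - y)) (x - y) t := by
      simpa using ((hasDerivAt_id t).smul_const (x - y)).const_add y
    have hcomp := (hdiff _ (hmem t ht)).comp_hasDerivAt t hline
    exact (hasDerivAt_pi.mp hcomp k).hasDerivWithinAt
  simpa using norm_image_sub_le_of_norm_deriv_le_segment_01' hderiv
    fun t ht => hJ _ (hmem t (Set.Ico_subset_Icc_self ht))

/-- Proposition 1(i): if the Fisher-weighted Jacobian satisfies
‖F_f(x)^{1/2} J(x)‖_{p↪2} ≤ L/√K on an open convex set B, then f is L-Lipschitz on B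
(w.r.t. Euclidean norms) and each component f_k is (L/√K)-Lipschitz on B. -/
theorem stmt_5 (K d : ℕ) (hK : 0 < K) (hd : 0 < d)
    (B : Set (Fin d → ℝ)) (hBopen : IsOpen B) (hBconv : Convex ℝ B)
    (f : (Fin d → ℝ) → (Fin K → ℝ))
    (J : (Fin d → ℝ) → Matrix (Fin K) (Fin d) ℝ)
    (hdiff : ∀ x ∈ B,
      HasFDerivAt f (LinearMap.toContinuousLinearMap (Matrix.mulVecLin (J x))) x)
    (hpos : ∀ x ∈ B, ∀ k, 0 < f x k ∧ f x k < 1)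
    (hsum : ∀ x ∈ B, ∑ k, f x k = 1)
    (p : ℝ≥0∞) (hp : 2 ≤ p) (L : ℝ) (hL : 0 < L)
    (hbound : ∀ x ∈ B,
      opNorm p 2 ((Matrix.diagonal fun k => (Real.sqrt (f x k))⁻¹) * J x)
        ≤ L / Real.sqrt (K : ℝ)) :
    (∀ x ∈ B, ∀ y ∈ B, lpNorm 2 (f x - f y) ≤ L * lpNorm 2 (x - y)) ∧
      (∀ k : Fin K, ∀ x ∈ B, ∀ y ∈ B,
        |f x k - f y k| ≤ (L / Real.sqrt (K : ℝ)) * lpNorm 2 (x - y)) := by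
  have hC : 0 ≤ L / Real.sqrt (K : ℝ) := by positivity
  have hcomp : ∀ k : Fin K, ∀ x ∈ B, ∀ y ∈ B,
      |f x k - f y k| ≤ (L / Real.sqrt (K : ℝ)) * lpNorm 2 (x - y) := fun k x hx y hy =>
    abs_apply_sub_le_of_abs_mulVec_le hBconv hdiff hx hy k fun z hz =>
      abs_mulVec_apply_le_of_weighted (hpos z hz) (J z) hp hC (hbound z hz) (x - y) k
  refine ⟨fun x hx y hy => ?_, hcomp⟩
  have hsqrt : Real.sqrt (K : ℝ) ≠ 0 := by positivity
  calc lpNorm 2 (f x - f y)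
      ≤ Real.sqrt K * (L / Real.sqrt K * lpNorm 2 (x - y)) :=
        lpNorm_two_le_sqrt_mul (mul_nonneg hC (lpNorm_nonneg 2 _)) fun k => hcomp k x hx y hy
    _ = L * lpNorm 2 (x - y) := by field_simp
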